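/- arXiv:math/0403212 — 3 statements merged into one kernel-verified Lean document; each statement's English description precedes it below -/
import Mathlib

section
/- Let H be a complex Hilbert space and let P and Q be orthogonal projections on H. Then for every x ∈ H, the sequence ((P∘Q∘P)^n x)_{n≥1} is a Cauchy sequence in H. -/
namespace ContinuousLinearMap

variable {𝕜 E : Type*} [RCLike 𝕜] [NormedAddCommGroup E] [InnerProductSpace 𝕜 E]

theorem re_inner_apply_self_le_of_norm_sq_le {A : E →L[𝕜] E}
    (hA : ∀ y, ‖A y‖ ^ 2 ≤ RCLike.re (inner 𝕜 (A y) y)) (y : E) :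
    RCLike.re (inner 𝕜 (A y) y) ≤ ‖y‖ ^ 2 := by
  have h := re_inner_le_norm (𝕜 := 𝕜) (A y) y
  nlinarith [hA y, sq_nonneg (‖A y‖ - ‖y‖)]

theorem inner_pow_apply_pow_apply {A : E →L[𝕜] E} (hsymm : A.IsSymmetric) (m n : ℕ) (x : E) :
    inner 𝕜 ((A ^ m) x) ((A ^ n) x) = inner 𝕜 ((A ^ (m + n)) x) x := by
  induction n generalizing m with
  | zero => simp
  | succ n ih =>
    have h : inner 𝕜 (A ((A ^ m) x)) ((A ^ n) x) = inner 𝕜 ((A ^ m) x) (A ((A ^ n) x)) :=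
      hsymm _ _
    rw [pow_succ' A n, mul_apply_eq_comp, ← h, ← mul_apply_eq_comp, ← pow_succ', ih,
      add_right_comm, add_assoc]

theorem antitone_re_inner_pow_apply {A : E →L[𝕜] E} (hsymm : A.IsSymmetric)
    (hA : ∀ y, ‖A y‖ ^ 2 ≤ RCLike.re (inner 𝕜 (A y) y)) (x : E) :
    Antitone fun k : ℕ => RCLike.re (inner 𝕜 ((A ^ k) x) x) := by
  refine antitone_nat_of_succ_le fun k => ?_
  have hsucc (m : ℕ) : A ((A ^ m) x) = (A ^ (m + 1)) x := by rw [pow_succ', mul_apply_eq_comp]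
  obtain ⟨m, rfl⟩ | ⟨m, rfl⟩ := k.even_or_odd
  · have h := re_inner_apply_self_le_of_norm_sq_le hA ((A ^ m) x)
    rwa [← inner_self_eq_norm_sq (𝕜 := 𝕜), hsucc, inner_pow_apply_pow_apply hsymm,
      inner_pow_apply_pow_apply hsymm, add_right_comm] at h
  · have h := hA ((A ^ m) x)
    rwa [← inner_self_eq_norm_sq (𝕜 := 𝕜), hsucc, inner_pow_apply_pow_apply hsymm,
      inner_pow_apply_pow_apply hsymm, ← add_assoc, add_right_comm m 1 m, ← two_mul] at h

theorem cauchySeq_pow_apply_of_norm_sq_le {A : E →L[𝕜] E} (hsymm : A.IsSymmetric)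
    (hA : ∀ y, ‖A y‖ ^ 2 ≤ RCLike.re (inner 𝕜 (A y) y)) (x : E) :
    CauchySeq fun n : ℕ => (A ^ n) x := by
  have hanti := antitone_re_inner_pow_apply hsymm hA x
  have hnorm (n : ℕ) : ‖(A ^ n) x‖ ^ 2 = RCLike.re (inner 𝕜 ((A ^ (n + n)) x) x) := by
    rw [← inner_self_eq_norm_sq (𝕜 := 𝕜), inner_pow_apply_pow_apply hsymm]
  have hanti_norm : Antitone fun n : ℕ => ‖(A ^ n) x‖ ^ 2 := fun m n hmn => by
    simpa only [hnorm] using hanti (add_le_add hmn hmn)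
  have hcauchy := (tendsto_atTop_ciInf hanti_norm
    ⟨0, by rintro _ ⟨n, rfl⟩; positivity⟩).cauchySeq
  rw [Metric.cauchySeq_iff'] at hcauchy ⊢
  intro ε hε
  obtain ⟨N, hN⟩ := hcauchy (ε ^ 2) (by positivity)
  refine ⟨N, fun n hn => ?_⟩
  have hlt := (abs_lt.mp (Real.dist_eq _ _ ▸ hN n hn)).1
  have hcross : ‖(A ^ n) x‖ ^ 2 ≤ RCLike.re (inner 𝕜 ((A ^ n) x) ((A ^ N) x)) := by
    rw [hnorm, inner_pow_apply_pow_apply hsymm]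
    exact hanti (by gcongr)
  rw [dist_eq_norm]
  refine lt_of_pow_lt_pow_left₀ 2 hε.le ?_
  rw [norm_sub_sq (𝕜 := 𝕜)]
  linarith

end ContinuousLinearMap

/-- For orthogonal projections `P`, `Q` on a complex Hilbert space and any `x`,
the sequence `((P∘Q∘P)^n x)ₙ` is Cauchy. -/
theorem PQP_pow_apply_cauchySeq
    {H : Type*} [NormedAddCommGroup H] [InnerProductSpace ℂ H] [CompleteSpace H]
    (P Q : H →L[ℂ] H)
    (hP : IsSelfAdjoint P) (hPidem : P ∘L P = P)
    (hQ : IsSelfAdjoint Q) (hQidem : Q ∘L Q = Q)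
    (x : H) :
    CauchySeq (fun n : ℕ => (((P ∘L Q ∘L P) ^ (n + 1))) x) := by
  have hPsymm (u v : H) : inner ℂ (P u) v = inner ℂ u (P v) := hP.isSymmetric u v
  have hQsymm (u v : H) : inner ℂ (Q u) v = inner ℂ u (Q v) := hQ.isSymmetric u v
  have hQQ (u : H) : Q (Q u) = Q u := DFunLike.congr_fun hQidem u
  have hPnorm : ‖P‖ ≤ 1 := IsStarProjection.norm_le P ⟨hPidem, hP⟩
  refine (cauchySeq_shift 1).mpr (ContinuousLinearMap.cauchySeq_pow_apply_of_norm_sq_le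
    (𝕜 := ℂ) (A := P ∘L Q ∘L P) (fun u v => ?_) (fun y => ?_) x)
  · simp [hPsymm, hQsymm]
  · calc ‖P (Q (P y))‖ ^ 2 ≤ ‖Q (P y)‖ ^ 2 := by
          gcongr
          exact P.le_of_opNorm_le_of_le hPnorm le_rfl |>.trans_eq (one_mul _)
      _ = RCLike.re (inner ℂ (P (Q (P y))) y) := by
          rw [← inner_self_eq_norm_sq (𝕜 := ℂ), ← hQsymm, hQQ, ← hPsymm]
end

section
/- Let H be a complex Hilbert space, let P and Q be orthogonal projections on H, and let W be a bounded operator on H such that (P∘Q∘P)^n x → W x for every x ∈ H. Then W∘W = W, W is self-adjoint, and for every x ∈ H, if W x = x then P x = x and Q x = x. -/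
open Filter

section PowerLimits

variable {𝕜 E : Type*} [RCLike 𝕜] [NormedAddCommGroup E]

/-- A pointwise limit of the powers of `T` takes values in the fixed points of `T`. -/
theorem ContinuousLinearMap.apply_limit_of_tendsto_pow [NormedSpace 𝕜 E] {T W : E →L[𝕜] E}
    (hW : ∀ x, Tendsto (fun n : ℕ => (T ^ n) x) atTop (nhds (W x))) (x : E) :
    T (W x) = W x := by
  have h₁ : Tendsto (fun n : ℕ => T ((T ^ n) x)) atTop (nhds (T (W x))) :=
    (T.continuous.tendsto _).comp (hW x)
  refine tendsto_nhds_unique h₁ (((hW x).comp (tendsto_add_atTop_nat 1)).congr fun n => ?_)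
  simp only [Function.comp_apply, pow_succ', mul_apply_eq_comp]

/-- A pointwise limit of the powers of an operator is idempotent. -/
theorem ContinuousLinearMap.comp_self_of_tendsto_pow [NormedSpace 𝕜 E] {T W : E →L[𝕜] E}
    (hW : ∀ x, Tendsto (fun n : ℕ => (T ^ n) x) atTop (nhds (W x))) :
    W ∘L W = W := by
  ext x
  have h : ∀ n : ℕ, (T ^ n) (W x) = W x := fun n => by
    induction n with
    | zero => simp
    | succ n ih => rw [pow_succ, mul_apply_eq_comp, apply_limit_of_tendsto_pow hW, ih]
  exact tendsto_nhds_unique (hW (W x)) (by simp only [h, tendsto_const_nhds])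

variable [InnerProductSpace 𝕜 E] [CompleteSpace E]

/-- A pointwise limit of self-adjoint operators is self-adjoint. -/
theorem IsSelfAdjoint.of_tendsto_apply {ι : Type*} {l : Filter ι} [l.NeBot]
    {S : ι → E →L[𝕜] E} {W : E →L[𝕜] E} (hS : ∀ i, IsSelfAdjoint (S i))
    (hW : ∀ x, Tendsto (fun i => S i x) l (nhds (W x))) : IsSelfAdjoint W := by
  rw [ContinuousLinearMap.isSelfAdjoint_iff_isSymmetric]
  intro x y
  refine tendsto_nhds_unique ((hW x).inner tendsto_const_nhds)
    ((tendsto_const_nhds.inner (hW y)).congr fun i => ?_)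
  exact ((hS i).isSymmetric x y).symm

/-- For orthogonal projections `P` and `Q`, a fixed point of `P ∘ Q ∘ P` is fixed by both. -/
theorem ContinuousLinearMap.fixed_of_projection_comp_fixed {P Q : E →L[𝕜] E}
    (hP : IsSelfAdjoint P) (hPidem : P ∘L P = P) (hQ : IsSelfAdjoint Q) (hQidem : Q ∘L Q = Q)
    {x : E} (hx : P (Q (P x)) = x) : P x = x ∧ Q x = x := by
  have hPx : P x = x := by
    conv_lhs => rw [← hx]
    rw [← ContinuousLinearMap.comp_apply P P, hPidem, hx]
  refine ⟨hPx, ?_⟩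
  rw [hPx] at hx
  have h₁ : inner 𝕜 (Q x) x = inner 𝕜 x x := by
    have := hP.isSymmetric (Q x) x
    simp only [ContinuousLinearMap.coe_coe, hx, hPx] at this
    exact this.symm
  have h₂ : inner 𝕜 x (Q x) = inner 𝕜 x x := (hQ.isSymmetric x x).symm.trans h₁
  have h₃ : inner 𝕜 (Q x) (Q x) = inner 𝕜 x x := by
    have := hQ.isSymmetric x (Q x)
    simp only [ContinuousLinearMap.coe_coe] at this
    rw [this, ← ContinuousLinearMap.comp_apply Q Q, hQidem, h₂]
  rw [← sub_eq_zero, ← inner_self_eq_zero (𝕜 := 𝕜), inner_sub_left, inner_sub_right,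
    inner_sub_right, h₁, h₂, h₃]
  simp

end PowerLimits

/-- If `(P∘Q∘P)^n x → W x` for every `x`, where `P`, `Q` are orthogonal projections and `W`
is a bounded operator, then `W` is a self-adjoint idempotent and every `W`-fixed vector is
fixed by both `P` and `Q`. -/
theorem limit_of_PQP_pow_is_projection
    {H : Type*} [NormedAddCommGroup H] [InnerProductSpace ℂ H] [CompleteSpace H]
    (P Q W : H →L[ℂ] H)
    (hP : IsSelfAdjoint P) (hPidem : P ∘L P = P)
    (hQ : IsSelfAdjoint Q) (hQidem : Q ∘L Q = Q)
    (hW : ∀ x : H, Tendsto (fun n : ℕ => (((P ∘L Q ∘L P) ^ n)) x) atTop (nhds (W x))) :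
    W ∘L W = W ∧ IsSelfAdjoint W ∧ ∀ x : H, W x = x → P x = x ∧ Q x = x := by
  have hT : IsSelfAdjoint (P ∘L Q ∘L P) := by
    have h := hQ.conj_adjoint P
    rwa [hP.adjoint_eq] at h
  refine ⟨ContinuousLinearMap.comp_self_of_tendsto_pow hW,
    IsSelfAdjoint.of_tendsto_apply (fun n => hT.pow n) hW, fun x hx => ?_⟩
  have h := ContinuousLinearMap.apply_limit_of_tendsto_pow hW x
  rw [hx] at h
  exact ContinuousLinearMap.fixed_of_projection_comp_fixed hP hPidem hQ hQidem h
end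

section
/- Let H = (ℝ/ℤ)^ι be a (possibly infinite-dimensional) torus, i.e., a product of copies of the circle group ℝ/ℤ indexed by a countable set ι, with its product topology and Haar probability measure. Let (Y, ℬ, μ, T) be an ergodic measure-preserving system, ρ : Y → H measurable, and suppose the abelian extension X = Y ×_ρ H (with T_X(y,h) = (T y, h + ρ(y))) is ergodic. Let σ : Y × H → S¹ be measurable and suppose there are a jointly measurable family (u,y,h) ↦ f_u(y,h) ∈ S¹ and a measurable family of constants u ↦ λ_u ∈ S¹ such that for every u ∈ H, σ(y, h+u) / σ(y,h) = λ_u · f_u(T_X(y,h)) / f_u(y,h) almost everywhere. Then there exist a closed subgroup J of H with H/J topologically isomorphic to a finite-dimensional torus (ℝ/ℤ)ⁿ, a measurable function σ̃ : Y × (H/J) → S¹, and a measurable function F : Y × H → S¹, such that σ(y,h) = σ̃(y, π(h)) · F(T_X(y,h)) / F(y,h) almost everywhere, where π : H → H/J is the canonical projection. -/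
open MeasureTheory

noncomputable instance Circle.borelMeasurableSpace : MeasurableSpace Circle := borel Circle

instance Circle.borelSpace : BorelSpace Circle := ⟨rfl⟩

/-- The distance of a point of the unit circle to `1`. -/
noncomputable def Circle.dev (z : Circle) : ℝ := ‖(z : ℂ) - 1‖

namespace Circle

lemma dev_nonneg (z : Circle) : 0 ≤ z.dev := norm_nonneg _

lemma dev_le_two (z : Circle) : z.dev ≤ 2 := by
  have := norm_sub_le (z : ℂ) 1
  simp only [norm_coe, norm_one] at this
  unfold dev; linarith

lemma dev_mul_inv (z w : Circle) : (z * w⁻¹).dev = ‖(z : ℂ) - w‖ := by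
  have : ((z * w⁻¹ : Circle) : ℂ) - 1 = ((z : ℂ) - w) * ((w⁻¹ : Circle) : ℂ) := by
    rw [sub_mul, ← coe_mul, ← coe_mul, mul_inv_cancel, coe_one]
  rw [dev, this, norm_mul, norm_coe, mul_one]

@[simp] lemma dev_inv (z : Circle) : z⁻¹.dev = z.dev := by
  have := dev_mul_inv 1 z
  rw [one_mul, coe_one, norm_sub_rev] at this
  exact this

lemma dev_mul_le (z w : Circle) : (z * w).dev ≤ z.dev + w.dev := by
  have : ((z * w : Circle) : ℂ) - 1 = ((z : ℂ) - 1) * w + ((w : ℂ) - 1) := by push_cast; ring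
  rw [dev, this]
  refine (norm_add_le _ _).trans ?_
  rw [norm_mul, norm_coe, mul_one]; rfl

lemma eq_one_of_dev_eq_zero {z : Circle} (h : z.dev = 0) : z = 1 := by
  rw [dev, norm_eq_zero, sub_eq_zero] at h
  exact Circle.ext (by simpa using h)

lemma continuous_dev : Continuous dev := by unfold dev; fun_prop

@[fun_prop] lemma measurable_dev : Measurable dev := continuous_dev.measurable

@[fun_prop] lemma measurable_coe_comp {α : Type*} [MeasurableSpace α] {f : α → Circle}
    (hf : Measurable f) : Measurable fun x => (f x : ℂ) :=
  (by fun_prop : Continuous fun z : Circle => (z : ℂ)).measurable.comp hf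

lemma dev_sq {z : Circle} (hz : z.dev ≤ 1 / 2) : 3 / 2 * z.dev ≤ (z * z).dev := by
  have h1 : ((z * z : Circle) : ℂ) - 1 = ((z : ℂ) - 1) * (((z : ℂ) - 1) + 2) := by
    push_cast; ring
  have h2 : 3 / 2 ≤ ‖((z : ℂ) - 1) + 2‖ := by
    have := norm_sub_le (((z : ℂ) - 1) + 2) ((z : ℂ) - 1)
    rw [add_sub_cancel_left] at this
    simp only [Complex.norm_ofNat] at this
    unfold dev at hz
    linarith
  rw [dev, dev, h1, norm_mul, mul_comm]
  gcongr

lemma eq_one_of_forall_dev_pow_le {z : Circle} (h : ∀ k : ℕ, (z ^ 2 ^ k).dev ≤ 1 / 2) : z = 1 := by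
  have key : ∀ k : ℕ, (3 / 2 : ℝ) ^ k * z.dev ≤ (z ^ 2 ^ k).dev := by
    intro k
    induction k with
    | zero => simp
    | succ k ih =>
      have := dev_sq (h k)
      rw [← pow_two, ← pow_mul, ← pow_succ] at this
      calc _ = 3 / 2 * ((3 / 2 : ℝ) ^ k * z.dev) := by ring
        _ ≤ 3 / 2 * (z ^ 2 ^ k).dev := by gcongr
        _ ≤ _ := this
  by_contra hne
  have hpos : 0 < z.dev := lt_of_le_of_ne z.dev_nonneg
    fun h0 => hne (eq_one_of_dev_eq_zero h0.symm)
  obtain ⟨k, hk⟩ := pow_unbounded_of_one_lt (1 / z.dev) (by norm_num : (1 : ℝ) < 3 / 2)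
  have h3 := (key k).trans (h k)
  rw [div_lt_iff₀ hpos] at hk
  linarith

/-- The radial projection of the plane to the unit circle (with `0 ↦ 1`). -/
noncomputable def ofComplex (z : ℂ) : Circle := Circle.exp z.arg

@[fun_prop] lemma measurable_ofComplex : Measurable ofComplex :=
  Circle.exp.continuous.measurable.comp Complex.measurable_arg

lemma coe_ofComplex {z : ℂ} (hz : z ≠ 0) : (ofComplex z : ℂ) = z / ‖z‖ := by
  have : (‖z‖ : ℂ) ≠ 0 := by simpa using hz
  rw [ofComplex, Circle.coe_exp, eq_div_iff this, mul_comm, Complex.norm_mul_exp_arg_mul_I]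

lemma ofComplex_mul_coe {z : ℂ} (hz : z ≠ 0) (w : Circle) :
    ofComplex (z * w) = ofComplex z * w := by
  apply Circle.ext
  rw [coe_mul, coe_ofComplex hz, coe_ofComplex (mul_ne_zero hz w.coe_ne_zero), norm_mul, norm_coe]
  push_cast; ring

lemma dev_ofComplex_le {z : ℂ} {r : ℝ} (hr : 0 < r) (hz : ‖z - r‖ ≤ r / 2) :
    (ofComplex z).dev ≤ 4 / r * ‖z - r‖ := by
  have h1 : r / 2 ≤ ‖z‖ := by
    have := norm_sub_norm_le (r : ℂ) z
    rw [norm_sub_rev] at this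
    simp only [Complex.norm_real, Real.norm_eq_abs, abs_of_pos hr] at this
    linarith
  have hz0 : 0 < ‖z‖ := by linarith
  have hne : (‖z‖ : ℂ) ≠ 0 := by exact_mod_cast hz0.ne'
  have h2 : |r - ‖z‖| ≤ ‖z - r‖ := by
    have := abs_norm_sub_norm_le (r : ℂ) z
    rw [norm_sub_rev] at this
    simpa only [Complex.norm_real, Real.norm_eq_abs, abs_of_pos hr] using this
  have h3 : z / ‖z‖ - 1 = ((z - r) + ((r - ‖z‖ : ℝ) : ℂ)) / ‖z‖ := by
    field_simp; push_cast; ring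
  rw [dev, coe_ofComplex (norm_pos_iff.1 hz0), h3, norm_div, Complex.norm_real, norm_norm,
    div_le_iff₀ hz0]
  calc _ ≤ ‖z - r‖ + ‖z - r‖ := by
        refine (norm_add_le _ _).trans ?_
        gcongr
        rwa [Complex.norm_real, Real.norm_eq_abs]
    _ = 4 / r * ‖z - r‖ * (r / 2) := by field_simp; ring
    _ ≤ _ := by gcongr

lemma re_pos_of_dev_lt_one {z : Circle} (h : z.dev < 1) : 0 < (z : ℂ).re := by
  have := (Complex.abs_re_le_norm ((z : ℂ) - 1)).trans_lt h
  rw [Complex.sub_re, Complex.one_re, abs_lt] at this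
  linarith [this.1]

lemma arg_mul_of_dev_lt_one {z w : Circle} (hz : z.dev < 1) (hw : w.dev < 1) :
    Complex.arg ((z * w : Circle) : ℂ) = Complex.arg z + Complex.arg w := by
  have h1 := Complex.abs_arg_lt_pi_div_two_iff.2 (Or.inl (re_pos_of_dev_lt_one hz))
  have h2 := Complex.abs_arg_lt_pi_div_two_iff.2 (Or.inl (re_pos_of_dev_lt_one hw))
  rw [abs_lt] at h1 h2
  rw [coe_mul]
  exact Complex.arg_mul z.coe_ne_zero w.coe_ne_zero
    ⟨by linarith [h1.1, h2.1], by linarith [h1.2, h2.2]⟩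

lemma abs_arg_le {z : Circle} (hz : z.dev ≤ 1 / 2) : |Complex.arg (z : ℂ)| ≤ 3 / 2 * z.dev := by
  have := Complex.norm_log_one_add_half_le_self (z := (z : ℂ) - 1) hz
  rw [add_sub_cancel] at this
  rw [← Complex.log_im]
  exact (Complex.abs_im_le_norm _).trans this

lemma dev_exp_le (t : ℝ) : (Circle.exp t).dev ≤ |t| := by
  have := Real.norm_exp_I_mul_ofReal_sub_one_le (x := t)
  rw [dev, coe_exp, mul_comm]
  exact this

end Circle

section MeanDev

open Circle Filter

variable {X : Type*} [MeasurableSpace X] {m : Measure X} [IsProbabilityMeasure m]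

/-- The `L¹` distance of a circle-valued function to the constant function `1`. -/
noncomputable def meanDev (m : Measure X) (φ : X → Circle) : ℝ := ∫ x, (φ x).dev ∂m

lemma integrable_dev {φ : X → Circle} (hφ : Measurable φ) : Integrable (fun x => (φ x).dev) m :=
  Integrable.of_bound (measurable_dev.comp hφ).aestronglyMeasurable 2 (.of_forall fun x => by
    rw [Real.norm_eq_abs, abs_of_nonneg (dev_nonneg _)]; exact dev_le_two _)

lemma meanDev_mul_le {φ ψ : X → Circle} (hφ : Measurable φ) (hψ : Measurable ψ) :
    meanDev m (fun x => φ x * ψ x) ≤ meanDev m φ + meanDev m ψ := by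
  unfold meanDev
  rw [← integral_add (integrable_dev hφ) (integrable_dev hψ)]
  exact integral_mono (integrable_dev (hφ.mul hψ))
    ((integrable_dev hφ).add (integrable_dev hψ)) fun x => dev_mul_le _ _

omit [IsProbabilityMeasure m] in
@[simp] lemma meanDev_inv (φ : X → Circle) : meanDev m (fun x => (φ x)⁻¹) = meanDev m φ := by
  simp [meanDev]

@[simp] lemma meanDev_const (c : Circle) : meanDev m (fun _ => c) = c.dev := by
  simp [meanDev]

omit [IsProbabilityMeasure m] in
lemma meanDev_congr {φ ψ : X → Circle} (h : ∀ᵐ x ∂m, φ x = ψ x) : meanDev m φ = meanDev m ψ :=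
  integral_congr_ae (h.mono fun x hx => by simp only [hx])

omit [IsProbabilityMeasure m] in
lemma meanDev_comp {φ : X → Circle} (hφ : Measurable φ) {W : X → X} (hW : MeasurePreserving W m m) :
    meanDev m (fun x => φ (W x)) = meanDev m φ := by
  unfold meanDev
  conv_rhs => rw [← hW.map_eq]
  exact (integral_map (f := fun x => (φ x).dev) hW.measurable.aemeasurable
    (measurable_dev.comp hφ).aestronglyMeasurable).symm

/-- An eigenfunction which is close to `1` is almost everywhere constant. -/
lemma ae_eq_const_of_meanDev_lt_one {S : X → X} (hS : Ergodic S m) {e : X → Circle}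
    (he : Measurable e) {κ : Circle} (heig : ∀ᵐ x ∂m, e (S x) = κ * e x) (h1 : meanDev m e < 1) :
    ∃ c : Circle, (∀ᵐ x ∂m, e x = c) ∧ c.dev ≤ meanDev m e := by
  have hint : Integrable (fun x => (e x : ℂ)) m :=
    Integrable.of_bound (by fun_prop) 1 (.of_forall fun x => (norm_coe _).le)
  have hne : ∫ x, (e x : ℂ) ∂m ≠ 0 := by
    intro h0
    have h2 : ‖∫ x, ((e x : ℂ) - 1) ∂m‖ ≤ meanDev m e := norm_integral_le_integral_norm _
    rw [integral_sub hint (integrable_const _), h0] at h2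
    simp at h2
    linarith
  have hκ : κ = 1 := by
    have h3 : ∫ x, (e (S x) : ℂ) ∂m = ∫ x, (e x : ℂ) ∂m := by
      conv_rhs => rw [← hS.toMeasurePreserving.map_eq]
      rw [integral_map hS.toMeasurePreserving.measurable.aemeasurable (by fun_prop)]
    have h4 : ∫ x, (e (S x) : ℂ) ∂m = κ * ∫ x, (e x : ℂ) ∂m := by
      rw [← integral_const_mul]
      exact integral_congr_ae (heig.mono fun x hx => by simp only [hx, coe_mul])
    rw [h3] at h4
    apply Circle.ext
    rw [coe_one]
    exact mul_right_cancel₀ hne (by rw [one_mul, ← h4])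
  obtain ⟨c, hc⟩ := hS.ae_eq_const_of_ae_eq_comp₀ he.nullMeasurable
    (heig.mono fun x hx => by simp [hx, hκ])
  exact ⟨c, hc, (meanDev_congr hc).trans (meanDev_const c) |>.ge⟩

/-- `φ` exhibits the quotient of `σ ∘ W` and `σ` as a coboundary, up to a constant. -/
def IsQuasiTransfer (m : Measure X) (S : X → X) (σ : X → Circle) (W : X → X) (φ : X → Circle) :
    Prop :=
  ∃ κ : Circle, ∀ᵐ x ∂m, σ (W x) * φ x = κ * σ x * φ (S x)

namespace IsQuasiTransfer

variable {S : X → X} {σ : X → Circle} {W W' : X → X} {φ ψ : X → Circle}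

lemma exists_ae_eq_mul (hS : Ergodic S m) (hφ : IsQuasiTransfer m S σ W φ)
    (hψ : IsQuasiTransfer m S σ W ψ) (hφm : Measurable φ) (hψm : Measurable ψ)
    (h1 : meanDev m φ + meanDev m ψ < 1) :
    ∃ c : Circle, (∀ᵐ x ∂m, φ x = c * ψ x) ∧ c.dev ≤ meanDev m φ + meanDev m ψ := by
  obtain ⟨κ, hκ⟩ := hφ
  obtain ⟨κ', hκ'⟩ := hψ
  have hle : meanDev m (fun x => φ x * (ψ x)⁻¹) ≤ meanDev m φ + meanDev m ψ := by
    refine (meanDev_mul_le hφm hψm.inv).trans ?_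
    rw [show meanDev m ψ⁻¹ = _ from meanDev_inv ψ]
  obtain ⟨c, hc, hc'⟩ := ae_eq_const_of_meanDev_lt_one hS (hφm.mul hψm.inv) (κ := κ⁻¹ * κ') (by
    filter_upwards [hκ, hκ'] with x h h'
    have e1 : φ (S x) = κ⁻¹ * (σ x)⁻¹ * (σ (W x) * φ x) := by
      rw [← mul_inv, eq_inv_mul_iff_mul_eq, h]
    have e2 : ψ (S x) = κ'⁻¹ * (σ x)⁻¹ * (σ (W x) * ψ x) := by
      rw [← mul_inv, eq_inv_mul_iff_mul_eq, h']
    simp only [Pi.mul_apply, Pi.inv_apply, e1, e2, mul_inv, inv_inv]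
    rw [← mul_inv_eq_one]
    simp only [mul_inv, inv_inv]
    calc _ = (κ⁻¹ * κ) * (κ' * κ'⁻¹) * ((σ x)⁻¹ * σ x) * (σ (W x) * (σ (W x))⁻¹) *
          (φ x * (φ x)⁻¹) * (ψ x * (ψ x)⁻¹) := by ac_rfl
      _ = 1 := by simp) (hle.trans_lt h1)
  exact ⟨c, hc.mono fun x hx => by rw [← hx]; simp, hc'.trans hle⟩

omit [IsProbabilityMeasure m] in
lemma const_mul (hφ : IsQuasiTransfer m S σ W φ) (c : Circle) :
    IsQuasiTransfer m S σ W (fun x => c * φ x) := by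
  obtain ⟨κ, hκ⟩ := hφ
  refine ⟨κ, hκ.mono fun x hx => ?_⟩
  beta_reduce; rw [mul_left_comm, hx]; ac_rfl

omit [IsProbabilityMeasure m] in
lemma congr (hS : MeasurePreserving S m m) (hφ : IsQuasiTransfer m S σ W φ)
    (h : ∀ᵐ x ∂m, ψ x = φ x) : IsQuasiTransfer m S σ W ψ := by
  obtain ⟨κ, hκ⟩ := hφ
  refine ⟨κ, ?_⟩
  filter_upwards [hκ, h, hS.quasiMeasurePreserving.ae h] with x h1 h2 h3
  rw [h2, h3, h1]

omit [IsProbabilityMeasure m] in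
/-- Transfer functions compose like cocycles. -/
lemma comp (hW : MeasurePreserving W m m) (hWS : ∀ x, S (W x) = W (S x))
    (hφ : IsQuasiTransfer m S σ W φ) (hψ : IsQuasiTransfer m S σ W' ψ) :
    IsQuasiTransfer m S σ (W' ∘ W) (fun x => φ x * ψ (W x)) := by
  obtain ⟨κ, hκ⟩ := hφ
  obtain ⟨κ', hκ'⟩ := hψ
  refine ⟨κ * κ', ?_⟩
  filter_upwards [hκ, hW.quasiMeasurePreserving.ae hκ'] with x h1 h2
  rw [hWS] at h2
  calc _ = φ x * (σ (W' (W x)) * ψ (W x)) := by simp only [Function.comp]; ac_rfl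
    _ = (σ (W x) * φ x) * (κ' * ψ (W (S x))) := by rw [h2]; ac_rfl
    _ = _ := by rw [h1]; ac_rfl

end IsQuasiTransfer

section Selection

variable {H : Type*} [MeasurableSpace H] {ν : Measure H} [IsProbabilityMeasure ν]

/-- The part of the average over `v` of a family of circle-valued functions coming from those
functions which are close to `1`. -/
noncomputable def nearOneAverage (m : Measure X) (ν : Measure H) (ε : ℝ) (φ : H → X → Circle)
    (x : X) : ℂ :=
  ∫ v, {v | meanDev m (φ v) ≤ ε}.indicator (fun v => (φ v x : ℂ)) v ∂ν

lemma measurable_meanDev {φ : H → X → Circle} (hφ : Measurable (Function.uncurry φ)) :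
    Measurable fun v => meanDev m (φ v) :=
  (StronglyMeasurable.integral_prod_right (f := fun v x => (φ v x).dev)
    (measurable_dev.comp hφ).stronglyMeasurable).measurable

lemma measurable_nearOneAverage {P : Type*} [MeasurableSpace P] (ε : ℝ) {φ : P → H → X → Circle}
    (hφ : Measurable fun q : P × H × X => φ q.1 q.2.1 q.2.2) :
    Measurable fun q : P × X => nearOneAverage m ν ε (φ q.1) q.2 := by
  have hset : MeasurableSet {q : P × H | meanDev m (φ q.1 q.2) ≤ ε} := by
    refine measurableSet_le ?_ measurable_const
    exact measurable_meanDev (φ := fun q : P × H => φ q.1 q.2)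
      (hφ.comp (f := fun z : (P × H) × X => (z.1.1, z.1.2, z.2)) (by fun_prop))
  refine (StronglyMeasurable.integral_prod_right (f := fun (q : P × X) (v : H) =>
    {v | meanDev m (φ q.1 v) ≤ ε}.indicator (fun v => (φ q.1 v q.2 : ℂ)) v) ?_).measurable
  refine Measurable.stronglyMeasurable ?_
  have h1 : Measurable fun z : (P × X) × H => (φ z.1.1 z.2 z.1.2 : ℂ) :=
    measurable_coe_comp
      (hφ.comp (f := fun z : (P × X) × H => (z.1.1, z.2, z.1.2)) (by fun_prop))
  exact h1.indicator (hset.preimage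
    (f := fun z : (P × X) × H => (z.1.1, z.2)) (by fun_prop))

variable {S : X → X} {σ : X → Circle} {W : X → X}

/-- Averaging those transfer functions of a measurable family which are close to `1` produces a
transfer function close to `1`. -/
lemma IsQuasiTransfer.nearOneAverage (hS : Ergodic S m) {ε : ℝ} (hε0 : 0 < ε) (hε : ε ≤ 1 / 4)
    {φ : H → X → Circle} (hφm : Measurable (Function.uncurry φ))
    (hφ : ∀ v, IsQuasiTransfer m S σ W (φ v)) (hI : ∫ v, meanDev m (φ v) ∂ν < ε) :
    IsQuasiTransfer m S σ W (fun x => ofComplex (nearOneAverage m ν ε φ x)) ∧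
      meanDev m (fun x => ofComplex (_root_.nearOneAverage m ν ε φ x)) ≤ 9 * ε := by
  set A : Set H := {v | meanDev m (φ v) ≤ ε} with hA
  have hAm : MeasurableSet A := measurableSet_le (measurable_meanDev hφm) measurable_const
  have hφv (v : H) : Measurable (φ v) := hφm.comp (by fun_prop : Measurable fun x => (v, x))
  have hint : Integrable (fun v => meanDev m (φ v)) ν :=
    (integrable_dev (m := ν.prod m) hφm).integral_prod_left
  have hνA : ν A ≠ 0 := by
    intro h0
    have : ∀ᵐ v ∂ν, ε ≤ meanDev m (φ v) := by
      filter_upwards [measure_eq_zero_iff_ae_notMem.1 h0] with v hv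
      exact (not_le.1 hv).le
    have h2 := integral_mono_ae (integrable_const ε) hint this
    simp at h2
    linarith
  obtain ⟨v₀, hv₀⟩ := nonempty_of_measure_ne_zero hνA
  set r : ℝ := ν.real A
  have hr : 0 < r := ENNReal.toReal_pos hνA (measure_ne_top _ _)
  have key : ∀ v ∈ A, ∃ c : Circle, (∀ᵐ x ∂m, φ v x = c * φ v₀ x) ∧ c.dev ≤ 2 * ε := by
    intro v hv
    have hv' : meanDev m (φ v) ≤ ε := hv
    have hv₀' : meanDev m (φ v₀) ≤ ε := hv₀
    obtain ⟨c, hc, hc'⟩ := (hφ v).exists_ae_eq_mul hS (hφ v₀) (hφv v) (hφv v₀) (by linarith)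
    exact ⟨c, hc, by linarith⟩
  set z : H → ℂ := fun v => ∫ x, ((φ v x * (φ v₀ x)⁻¹ : Circle) : ℂ) ∂m with hz
  have hrm : Measurable fun p : H × X => φ p.1 p.2 * (φ v₀ p.2)⁻¹ :=
    (show Measurable fun p : H × X => φ p.1 p.2 from hφm).mul ((hφv v₀).comp measurable_snd).inv
  have hzm : Measurable z := (StronglyMeasurable.integral_prod_right
    (f := fun v x => ((φ v x * (φ v₀ x)⁻¹ : Circle) : ℂ))
    (measurable_coe_comp hrm).stronglyMeasurable).measurable
  have hzA : ∀ v ∈ A, ∃ c : Circle, (∀ᵐ x ∂m, φ v x = c * φ v₀ x) ∧ c.dev ≤ 2 * ε ∧ z v = c := by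
    intro v hv
    obtain ⟨c, hc, hc'⟩ := key v hv
    refine ⟨c, hc, hc', ?_⟩
    have : z v = ∫ _, (c : ℂ) ∂m :=
      integral_congr_ae (hc.mono fun x hx => by simp only [hx, mul_inv_cancel_right])
    simpa using this
  set C : ℂ := ∫ v, A.indicator z v ∂ν
  have hintA : Integrable (A.indicator z) ν := by
    refine Integrable.of_bound (hzm.indicator hAm).aestronglyMeasurable 1 (.of_forall fun v => ?_)
    by_cases hv : v ∈ A
    · obtain ⟨c, -, -, h⟩ := hzA v hv
      rw [Set.indicator_of_mem hv, h, norm_coe]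
    · rw [Set.indicator_of_notMem hv]; simp
  have hC : ‖C - r‖ ≤ 2 * ε * r := by
    have h1 : (r : ℂ) = ∫ v, A.indicator (fun _ => (1 : ℂ)) v ∂ν := by
      rw [integral_indicator hAm]; simp [r]
    rw [h1, ← integral_sub hintA ((integrable_const _).indicator hAm)]
    have h2 : ∫ v, A.indicator (fun _ => 2 * ε) v ∂ν = 2 * ε * r := by
      rw [integral_indicator hAm]; simp [r, mul_comm]
    rw [← h2]
    refine norm_integral_le_of_norm_le ((integrable_const _).indicator hAm) (.of_forall fun v => ?_)
    by_cases hv : v ∈ A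
    · obtain ⟨c, -, h', h⟩ := hzA v hv
      simp only [Set.indicator_of_mem hv, h]
      exact h'
    · simp [Set.indicator_of_notMem hv]
  have hC2 : ‖C - r‖ ≤ r / 2 := hC.trans (by nlinarith)
  have hC0 : C ≠ 0 := by
    rintro h0
    rw [h0, zero_sub, norm_neg, Complex.norm_real, Real.norm_eq_abs, abs_of_pos hr] at hC2
    linarith
  have hdev : (ofComplex C).dev ≤ 8 * ε := by
    refine (dev_ofComplex_le hr hC2).trans ?_
    calc _ ≤ 4 / r * (2 * ε * r) := by gcongr
      _ = _ := by field_simp; ring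
  have hcomm : ∀ᵐ x ∂m, ∀ᵐ v ∂ν, v ∈ A → ((φ v x * (φ v₀ x)⁻¹ : Circle) : ℂ) = z v := by
    refine (Measure.ae_ae_comm ?_).1 (.of_forall fun v => ?_)
    · have h1 : MeasurableSet {p : H × X | p.1 ∈ A} := hAm.preimage measurable_fst
      have h2 : MeasurableSet {p : H × X | ((φ p.1 p.2 * (φ v₀ p.2)⁻¹ : Circle) : ℂ) = z p.1} :=
        measurableSet_eq_fun (measurable_coe_comp hrm) (hzm.comp measurable_fst)
      convert! h1.compl.union h2 using 1
      ext p
      simp [imp_iff_not_or]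
    · by_cases hv : v ∈ A
      · obtain ⟨c, hc, -, h⟩ := hzA v hv
        filter_upwards [hc] with x hx _
        rw [h, hx, mul_inv_cancel_right]
      · exact .of_forall fun x hx => absurd hx hv
  have hG : ∀ᵐ x ∂m, ofComplex (_root_.nearOneAverage m ν ε φ x) = ofComplex C * φ v₀ x := by
    filter_upwards [hcomm] with x hx
    rw [← ofComplex_mul_coe hC0]
    congr 1
    rw [_root_.nearOneAverage, ← integral_mul_const]
    refine integral_congr_ae (hx.mono fun v hv => ?_)
    by_cases hvA : v ∈ A
    · simp only [Set.indicator_of_mem hvA, ← hA]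
      rw [← hv hvA, ← coe_mul, inv_mul_cancel_right]
    · simp only [Set.indicator_of_notMem hvA, ← hA, zero_mul]
  refine ⟨((hφ v₀).const_mul _).congr hS.toMeasurePreserving hG, ?_⟩
  rw [meanDev_congr hG]
  refine (meanDev_mul_le measurable_const (hφv v₀)).trans ?_
  rw [meanDev_const]
  have hv₀' : meanDev m (φ v₀) ≤ ε := hv₀
  linarith

end Selection

section Action

variable {H : Type*} [AddCommGroup H] [MeasurableSpace H] [MeasurableAdd₂ H] {ν : Measure H}
  [IsProbabilityMeasure ν] [ν.IsAddLeftInvariant]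
  {S : X → X} {σ : X → Circle} {V : H → X → X}

/-- Transfer functions close to `1` can be rescaled so as to satisfy the cocycle identity. -/
lemma exists_rescaling_to_cocycle (hS : Ergodic S m) (hVm : Measurable (Function.uncurry V))
    (hVp : ∀ u, MeasurePreserving (V u) m m) (hVadd : ∀ u v x, V (u + v) x = V v (V u x))
    (hVS : ∀ u x, S (V u x) = V u (S x)) {g : H → X → Circle}
    (hgm : Measurable (Function.uncurry g)) (hg : ∀ u, IsQuasiTransfer m S σ (V u) (g u))
    {δ : ℝ} (hδ : δ ≤ 1 / 6) (hgδ : ∀ u, meanDev m (g u) ≤ δ) (ν : Measure H)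
    [IsProbabilityMeasure ν] [ν.IsAddLeftInvariant] :
    ∃ b : H → Circle, Measurable b ∧ (∀ u, (b u).dev ≤ 9 / 2 * δ) ∧
      ∀ u v, ∀ᵐ x ∂m, b (u + v) * g (u + v) x = b u * g u x * (b v * g v (V u x)) := by
  have hgu (u : H) : Measurable (g u) := hgm.comp (by fun_prop : Measurable fun x => (u, x))
  have hVV (u v : H) : V v ∘ V u = V (u + v) := funext fun x => (hVadd u v x).symm
  have hex (u v : H) : ∃ c : Circle, (∀ᵐ x ∂m, g (u + v) x = c * (g u x * g v (V u x))) ∧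
      c.dev ≤ 3 * δ := by
    have hmd : meanDev m (fun x => g u x * g v (V u x)) ≤ 2 * δ := by
      refine (meanDev_mul_le (hgu u) ((hgu v).comp (hVp u).measurable)).trans ?_
      rw [show meanDev m (g v ∘ V u) = _ from meanDev_comp (hgu v) (hVp u)]
      linarith [hgδ u, hgδ v]
    have hcomp := (hg u).comp (hVp u) (hVS u) (hg v)
    rw [hVV] at hcomp
    obtain ⟨c, hc, hc'⟩ := (hg (u + v)).exists_ae_eq_mul hS hcomp (hgu _)
      ((hgu u).mul ((hgu v).comp (hVp u).measurable)) (by linarith [hgδ (u + v)])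
    exact ⟨c, hc, by linarith [hgδ (u + v)]⟩
  choose c hc hcδ using hex
  set L : H → H → ℝ := fun u v => Complex.arg (c u v)
  have hLm : Measurable (Function.uncurry L) := by
    have h1 : Measurable fun p : (H × H) × X =>
        Complex.arg (g (p.1.1 + p.1.2) p.2 * (g p.1.1 p.2 * g p.1.2 (V p.1.1 p.2))⁻¹ : Circle) := by
      refine Complex.measurable_arg.comp (measurable_coe_comp (Measurable.mul ?_
        (Measurable.mul ?_ ?_).inv))
      · exact hgm.comp (f := fun p : (H × H) × X => (p.1.1 + p.1.2, p.2)) (by fun_prop)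
      · exact hgm.comp (f := fun p : (H × H) × X => (p.1.1, p.2)) (by fun_prop)
      · exact hgm.comp (f := fun p : (H × H) × X => (p.1.2, V p.1.1 p.2))
          ((by fun_prop : Measurable fun p : (H × H) × X => p.1.2).prodMk
            (hVm.comp (f := fun p : (H × H) × X => (p.1.1, p.2)) (by fun_prop)))
    have h2 := (StronglyMeasurable.integral_prod_right (ν := m)
      (f := fun (p : H × H) (x : X) => Complex.arg
        (g (p.1 + p.2) x * (g p.1 x * g p.2 (V p.1 x))⁻¹ : Circle))
      h1.stronglyMeasurable).measurable
    convert! h2 using 1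
    ext ⟨u, v⟩
    have : ∫ x, Complex.arg (g (u + v) x * (g u x * g v (V u x))⁻¹ : Circle) ∂m =
        ∫ _, L u v ∂m := integral_congr_ae ((hc u v).mono fun x hx => by
          simp only [hx, mul_inv_cancel_right, L])
    simp only [Function.uncurry_apply_pair, this, integral_const, probReal_univ, one_smul]
  have hLb (u v : H) : |L u v| ≤ 9 / 2 * δ := by
    refine (abs_arg_le ((hcδ u v).trans (by linarith))).trans ?_
    linarith [hcδ u v]
  have hLint (u : H) : Integrable (L u) ν :=
    Integrable.of_bound (hLm.comp (by fun_prop : Measurable fun v => (u, v))).aestronglyMeasurable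
      _ (.of_forall fun v => hLb u v)
  have hcoc (u v w : H) : c u v * c (u + v) w = c v w * c u (v + w) := by
    have h1 := hc (u + v) w
    rw [add_assoc] at h1
    obtain ⟨x, h1, h2, h3, h4⟩ := (h1.and ((hc u v).and (((hVp u).quasiMeasurePreserving.ae
      (hc v w)).and (hc u (v + w))))).exists
    rw [h2, hVadd] at h1
    rw [h3] at h4
    have h5 := h1.symm.trans h4
    refine mul_right_cancel (b := g u x * g v (V u x) * g w (V v (V u x))) ?_
    calc _ = c (u + v) w * (c u v * (g u x * g v (V u x)) * g w (V v (V u x))) := by ac_rfl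
      _ = _ := h5
      _ = _ := by ac_rfl
  have hLcoc (u v w : H) : L u v + L (u + v) w = L v w + L u (v + w) := by
    have h (u v : H) : (c u v).dev < 1 := (hcδ u v).trans_lt (by linarith)
    simp only [L]
    rw [← arg_mul_of_dev_lt_one (h _ _) (h _ _), hcoc, arg_mul_of_dev_lt_one (h _ _) (h _ _)]
  set a : H → ℝ := fun u => ∫ w, L u w ∂ν
  have hLa (u v : H) : L u v + a (u + v) = a v + a u := by
    have h1 : ∫ w, (L u v + L (u + v) w) ∂ν = ∫ w, (L v w + L u (v + w)) ∂ν :=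
      integral_congr_ae (.of_forall fun w => hLcoc u v w)
    rw [integral_add (integrable_const _) (hLint _),
      integral_add (hLint _) ((hLint u).comp_add_left v), integral_add_left_eq_self] at h1
    simpa using h1
  refine ⟨fun u => Circle.exp (a u), ?_, fun u => ?_, fun u v => ?_⟩
  · exact Circle.exp.continuous.measurable.comp
      (StronglyMeasurable.integral_prod_right hLm.stronglyMeasurable).measurable
  · refine (dev_exp_le _).trans ?_
    have := norm_integral_le_of_norm_le_const (μ := ν) (f := L u) (.of_forall fun w => hLb u w)
    simpa using this
  · have hcb : Circle.exp (a (u + v)) * c u v = Circle.exp (a v) * Circle.exp (a u) := by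
      rw [← Circle.exp_add, ← hLa, Circle.exp_add, mul_comm]
      simp only [L, Circle.exp_arg]
    filter_upwards [hc u v] with x hx
    rw [hx, ← mul_assoc, hcb]
    ac_rfl

/-- A family of transfer functions, small in mean, gives rise to an exact cocycle of transfer
functions. -/
lemma exists_cocycle_of_quasiTransfer (hS : Ergodic S m) (hVm : Measurable (Function.uncurry V))
    (hVp : ∀ u, MeasurePreserving (V u) m m) (hVadd : ∀ u v x, V (u + v) x = V v (V u x))
    (hVS : ∀ u x, S (V u x) = V u (S x)) (hσm : Measurable σ)
    {φ : H → H → X → Circle} (hφm : Measurable fun q : H × H × X => φ q.1 q.2.1 q.2.2)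
    (hφ : ∀ u v, IsQuasiTransfer m S σ (V u) (φ u v))
    (hI : ∀ u, ∫ v, meanDev m (φ u v) ∂ν < 1 / 400)
    (hσ : ∀ u, meanDev m (fun x => σ (V u x) * (σ x)⁻¹) ≤ 1 / 4) :
    ∃ g : H → X → Circle, Measurable (Function.uncurry g) ∧
      (∀ u v, ∀ᵐ x ∂m, g (u + v) x = g u x * g v (V u x)) ∧
      ∀ u, ∀ᵐ x ∂m, σ (V u x) * g u x = σ x * g u (S x) := by
  have hφu (u : H) : Measurable (Function.uncurry (φ u)) :=
    hφm.comp (by fun_prop : Measurable fun p : H × X => (u, p.1, p.2))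
  set g₀ : H → X → Circle := fun u x => ofComplex (nearOneAverage m ν (1 / 400) (φ u) x)
  have hg₀m : Measurable (Function.uncurry g₀) :=
    measurable_ofComplex.comp (measurable_nearOneAverage (1 / 400) hφm)
  have hg₀ (u : H) := IsQuasiTransfer.nearOneAverage (ν := ν) hS (by norm_num : (0 : ℝ) < 1 / 400)
    (by norm_num) (hφu u) (hφ u) (hI u)
  obtain ⟨b, hbm, hbδ, hb⟩ := exists_rescaling_to_cocycle hS hVm hVp hVadd hVS hg₀m
    (fun u => (hg₀ u).1) (by norm_num : (9 * (1 / 400) : ℝ) ≤ 1 / 6) (fun u => (hg₀ u).2) ν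
  set g : H → X → Circle := fun u x => b u * g₀ u x
  have hgm : Measurable (Function.uncurry g) := (hbm.comp measurable_fst).mul hg₀m
  have hgu (u : H) : Measurable (g u) := hgm.comp (by fun_prop : Measurable fun x => (u, x))
  have hgδ (u : H) : meanDev m (g u) ≤ 11 / 2 * (9 * (1 / 400)) := by
    refine (meanDev_mul_le measurable_const
      (hg₀m.comp (by fun_prop : Measurable fun x => (u, x)))).trans ?_
    rw [meanDev_const]
    have := (hg₀ u).2
    have := hbδ u
    simp only [Function.comp_def, Function.uncurry_apply_pair, g₀]
    linarith
  have hgt (u : H) : IsQuasiTransfer m S σ (V u) (g u) := (hg₀ u).1.const_mul _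
  choose κ hκ using hgt
  have hκadd (u v : H) : κ (u + v) = κ u * κ v := by
    obtain ⟨x, h1, h2, h3, h4, h5⟩ := ((hκ (u + v)).and ((hκ u).and
      (((hVp u).quasiMeasurePreserving.ae (hκ v)).and ((hb u v).and
      (hS.toMeasurePreserving.quasiMeasurePreserving.ae (hb u v)))))).exists
    change g (u + v) x = g u x * g v (V u x) at h4
    change g (u + v) (S x) = g u (S x) * g v (V u (S x)) at h5
    rw [hVadd] at h1
    rw [hVS] at h3
    rw [h4, h5] at h1
    refine mul_right_cancel (b := σ x * (g u (S x) * g v (V u (S x)))) ?_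
    calc _ = σ (V v (V u x)) * (g u x * g v (V u x)) := by rw [h1]; ac_rfl
      _ = g u x * (σ (V v (V u x)) * g v (V u x)) := by ac_rfl
      _ = (σ (V u x) * g u x) * (κ v * g v (V u (S x))) := by rw [h3]; ac_rfl
      _ = _ := by rw [h2]; ac_rfl
  have hκδ (u : H) : (κ u).dev ≤ 1 / 2 := by
    have h1 : ∀ᵐ x ∂m, (σ (V u x) * (σ x)⁻¹) * (g u x * (g u (S x))⁻¹) = κ u := by
      filter_upwards [hκ u] with x hx
      calc _ = σ (V u x) * g u x * (σ x * g u (S x))⁻¹ := by rw [mul_inv (σ x)]; ac_rfl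
        _ = κ u := by rw [hx, mul_assoc (κ u), mul_inv_cancel_right]
    have hgS : Measurable fun x => g u (S x) := (hgu u).comp hS.measurable
    rw [← meanDev_const (m := m) (κ u), ← meanDev_congr h1]
    refine (meanDev_mul_le ((hσm.comp (hVp u).measurable).mul hσm.inv)
      ((hgu u).mul hgS.inv)).trans ?_
    have h2 := meanDev_mul_le (m := m) (hgu u) hgS.inv
    rw [show meanDev m (fun x => g u (S x))⁻¹ = _ from meanDev_inv _,
      meanDev_comp (hgu u) hS.toMeasurePreserving] at h2
    have h3 := hgδ u
    have h4 := hσ u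
    simp only [Pi.mul_def, Pi.inv_def, Function.comp_def] at h2 ⊢
    linarith
  have hκpow (k : ℕ) : ∀ u, ((κ u) ^ 2 ^ k).dev ≤ 1 / 2 := by
    induction k with
    | zero => simpa using hκδ
    | succ k ih =>
      intro u
      have := ih (u + u)
      rwa [hκadd, ← pow_two, ← pow_mul, ← pow_succ'] at this
  refine ⟨g, hgm, hb, fun u => ?_⟩
  have h1 := hκ u
  rw [eq_one_of_forall_dev_pow_le fun k => hκpow k u] at h1
  simpa only [one_mul] using h1

end Action

end MeanDev

section SkewProduct

open Circle

variable {Y H : Type*} [MeasurableSpace Y] {μ : Measure Y} [IsProbabilityMeasure μ]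
  [AddCommGroup H] [MeasurableSpace H] [MeasurableAdd₂ H] [MeasurableNeg H] {ν : Measure H}
  [IsProbabilityMeasure ν] [ν.IsAddLeftInvariant]

/-- The translation of the fibre `H` of `Y × H` by `u`. -/
def fiberShift (Y : Type*) {H : Type*} [AddCommGroup H] (u : H) (q : Y × H) : Y × H :=
  (q.1, q.2 + u)

omit [MeasurableNeg H] [IsProbabilityMeasure μ] in
lemma measurePreserving_fiberShift [SFinite μ] (u : H) :
    MeasurePreserving (fiberShift Y u) (μ.prod ν) (μ.prod ν) :=
  (MeasurePreserving.id μ).prod (measurePreserving_add_right ν u)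

omit [IsProbabilityMeasure μ] [IsProbabilityMeasure ν] in
/-- A property holding for almost every shift holds almost everywhere for the shift moving the
fibre coordinate to a generic position. -/
lemma ae_ae_sub_snd [SFinite μ] [SFinite ν] {P : H → Y × H → Prop}
    (hP : MeasurableSet {z : H × (Y × H) | P z.1 z.2})
    (h : ∀ᵐ u ∂ν, ∀ᵐ q ∂μ.prod ν, P u q) :
    ∀ᵐ w ∂ν, ∀ᵐ q ∂μ.prod ν, P (w - q.2) q := by
  have h1 := ((Measure.ae_ae_comm hP).1 h).mono fun q hq =>
    (measurePreserving_sub_right ν q.2).quasiMeasurePreserving.ae hq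
  refine (Measure.ae_ae_comm (p := fun (q : Y × H) w => P (w - q.2) q) ?_).1 h1
  exact hP.preimage (f := fun z : (Y × H) × H => (z.2 - z.1.2, z.1)) (by fun_prop)

variable {T : Y → Y} {ρ : Y → H}

/-- If, for `u` in the range of a projection `p`, the functions `σ ∘ fiberShift u / σ` are
coboundaries of a measurable cocycle, then `σ` is cohomologous to a function factoring through
the quotient by this range. -/
lemma exists_cohomologous_of_cocycle {σ : Y × H → Circle}
    (hS : MeasurePreserving (fun q : Y × H => (T q.1, q.2 + ρ q.1)) (μ.prod ν) (μ.prod ν))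
    (hσm : Measurable σ) {p : H →+ H} (hpm : Measurable p) (hpp : ∀ u, p (p u) = p u)
    {g : H → Y × H → Circle} (hgm : Measurable (Function.uncurry g))
    (hg : ∀ u v, ∀ᵐ q ∂μ.prod ν, g (u + v) q = g u q * g v (fiberShift Y (p u) q))
    (hgσ : ∀ u, ∀ᵐ q ∂μ.prod ν,
      σ (fiberShift Y (p u) q) * g u q = σ q * g u (T q.1, q.2 + ρ q.1)) :
    ∃ (w : H) (s F : Y × H → Circle), Measurable s ∧ Measurable F ∧
      ∀ᵐ q ∂μ.prod ν,
        σ q = s (q.1, q.2 + p (w - q.2)) * (F (T q.1, q.2 + ρ q.1) * (F q)⁻¹) := by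
  set S : Y × H → Y × H := fun q => (T q.1, q.2 + ρ q.1)
  have hSm : Measurable S := hS.measurable
  set G : H → Y × H → Circle := fun u q => g (p u) q
  have hGm : Measurable (Function.uncurry G) :=
    hgm.comp ((hpm.comp measurable_fst).prodMk measurable_snd)
  have hVm : Measurable fun z : H × (Y × H) => fiberShift Y (p z.1) z.2 :=
    Measurable.prodMk (by fun_prop) (by fun_prop)
  have hG (u v : H) : ∀ᵐ q ∂μ.prod ν, G v q = G u q * G (v - p u) (fiberShift Y (p u) q) := by
    have e : p u + p (v - p u) = p v := by rw [map_sub, hpp]; abel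
    have := hg (p u) (p (v - p u))
    rwa [hpp, e] at this
  have hGσ (u : H) : ∀ᵐ q ∂μ.prod ν, σ (fiberShift Y (p u) q) * G u q = σ q * G u (S q) := by
    have := hgσ (p u)
    rwa [hpp] at this
  have hset : MeasurableSet {z : H × (H × (Y × H)) | G z.2.1 z.2.2 =
      G z.1 z.2.2 * G (z.2.1 - p z.1) (fiberShift Y (p z.1) z.2.2)} := by
    refine measurableSet_eq_fun ?_ (Measurable.mul ?_ ?_)
    · exact hGm.comp (f := fun z : H × (H × (Y × H)) => z.2) (by fun_prop)
    · exact hGm.comp (f := fun z : H × (H × (Y × H)) => (z.1, z.2.2)) (by fun_prop)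
    · exact hGm.comp (f := fun z : H × (H × (Y × H)) =>
        (z.2.1 - p z.1, fiberShift Y (p z.1) z.2.2)) (Measurable.prodMk (by fun_prop)
          (hVm.comp (f := fun z : H × (H × (Y × H)) => (z.1, z.2.2)) (by fun_prop)))
  have hG1 (u : H) : ∀ᵐ z ∂ν.prod (μ.prod ν), G (z.1 - z.2.2) z.2 =
      G u z.2 * G (z.1 - z.2.2 - p u) (fiberShift Y (p u) z.2) := by
    rw [Measure.ae_prod_iff_ae_ae]
    · exact ae_ae_sub_snd (P := fun v q => G v q = G u q * G (v - p u) (fiberShift Y (p u) q))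
        (hset.preimage (f := fun z : H × (Y × H) => (u, z)) (by fun_prop))
        (.of_forall fun v => hG u v)
    · exact hset.preimage (f := fun z : H × (Y × H) => (u, (z.1 - z.2.2, z.2))) (by fun_prop)
  have hG2 := (Measure.ae_ae_comm (μ := ν) (ν := ν.prod (μ.prod ν))
    (p := fun u z => G (z.1 - z.2.2) z.2 =
      G u z.2 * G (z.1 - z.2.2 - p u) (fiberShift Y (p u) z.2))
    (hset.preimage (f := fun z : H × (H × (Y × H)) => (z.1, (z.2.1 - z.2.2.2, z.2.2)))
      (by fun_prop))).1 (.of_forall hG1)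
  obtain ⟨w₀, hw₀⟩ := (Measure.ae_ae_of_ae_prod hG2).exists
  set F : Y × H → Circle := fun q => (G (w₀ - q.2) q)⁻¹
  have hFm : Measurable F :=
    (hGm.comp (f := fun q : Y × H => (w₀ - q.2, q)) (by fun_prop)).inv
  have hF : ∀ᵐ q ∂μ.prod ν, ∀ᵐ u ∂ν, F (fiberShift Y (p u) q) = G u q * F q := by
    filter_upwards [hw₀] with q hq
    filter_upwards [hq] with u hu
    simp only [F, hu, mul_inv, mul_inv_cancel_left]
    simp only [fiberShift, sub_sub]
  have hGσ' := (Measure.ae_ae_comm (μ := ν) (ν := μ.prod ν)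
    (p := fun u q => σ (fiberShift Y (p u) q) * G u q = σ q * G u (S q))
    (measurableSet_eq_fun ((hσm.comp hVm).mul hGm) ((hσm.comp measurable_snd).mul
      (hGm.comp (measurable_fst.prodMk (hSm.comp measurable_snd)))))).1 (.of_forall hGσ)
  set s : Y × H → Circle := fun q => σ q * F q * (F (S q))⁻¹
  have hsm : Measurable s := (hσm.mul hFm).mul (hFm.comp hSm).inv
  have hVS (u : H) (q : Y × H) : S (fiberShift Y u q) = fiberShift Y u (S q) := by
    simp only [S, fiberShift, add_right_comm]
  have hs : ∀ᵐ q ∂μ.prod ν, ∀ᵐ u ∂ν, s (fiberShift Y (p u) q) = s q := by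
    filter_upwards [hF, hS.quasiMeasurePreserving.ae hF, hGσ'] with q h1 h2 h3
    filter_upwards [h1, h2, h3] with u h1 h2 h3
    simp only [s, hVS, h1, h2, mul_inv]
    calc _ = (σ (fiberShift Y (p u) q) * G u q) * (F q * ((G u (S q))⁻¹ * (F (S q))⁻¹)) := by
          ac_rfl
      _ = σ q * F q * (F (S q))⁻¹ * (G u (S q) * (G u (S q))⁻¹) := by rw [h3]; ac_rfl
      _ = _ := by rw [mul_inv_cancel, mul_one]
  have hsset : MeasurableSet {z : H × (Y × H) | s (fiberShift Y (p z.1) z.2) = s z.2} :=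
    measurableSet_eq_fun (hsm.comp hVm) (hsm.comp measurable_snd)
  obtain ⟨w, hw⟩ := (ae_ae_sub_snd (P := fun u q => s (fiberShift Y (p u) q) = s q) hsset
    ((Measure.ae_ae_comm (μ := μ.prod ν) (ν := ν)
      (p := fun q u => s (fiberShift Y (p u) q) = s q) (hsset.preimage measurable_swap)).1
        hs)).exists
  refine ⟨w, s, F, hsm, hFm, hw.mono fun q hq => ?_⟩
  change σ q = s (fiberShift Y (p (w - q.2)) q) * (F (S q) * (F q)⁻¹)
  rw [hq]
  calc σ q = σ q * (F q * (F q)⁻¹) * ((F (S q))⁻¹ * F (S q)) := by simp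
    _ = _ := by simp only [s]; ac_rfl

omit [MeasurableNeg H] in
/-- A transfer function for the shift by `v + u` and one for the shift by `v` combine to one
for the shift by `u`. -/
lemma IsQuasiTransfer.div_fiberShift {σ : Y × H → Circle} {f f' : Y × H → Circle} {u v : H}
    (hf : IsQuasiTransfer (μ.prod ν) (fun q : Y × H => (T q.1, q.2 + ρ q.1)) σ
      (fiberShift Y (v + u)) f)
    (hf' : IsQuasiTransfer (μ.prod ν) (fun q : Y × H => (T q.1, q.2 + ρ q.1)) σ
      (fiberShift Y v) f') :
    IsQuasiTransfer (μ.prod ν) (fun q : Y × H => (T q.1, q.2 + ρ q.1)) σ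
      (fiberShift Y u) fun q => f q * (f' (fiberShift Y u q))⁻¹ := by
  obtain ⟨κ, hκ⟩ := hf
  obtain ⟨κ', hκ'⟩ := hf'
  refine ⟨κ * κ'⁻¹, ?_⟩
  filter_upwards [hκ, (measurePreserving_fiberShift u).quasiMeasurePreserving.ae hκ'] with q h h'
  have e1 : fiberShift Y v (fiberShift Y u q) = fiberShift Y (v + u) q := by
    simp only [fiberShift, add_assoc, add_comm v u]
  have e2 : ((T (fiberShift Y u q).1, (fiberShift Y u q).2 + ρ (fiberShift Y u q).1) : Y × H) =
      fiberShift Y u (T q.1, q.2 + ρ q.1) := by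
    simp only [fiberShift, add_right_comm]
  rw [e1, e2] at h'
  have h2 := congrArg₂ (fun a b => a * b⁻¹) h h'
  simp only [mul_inv] at h2
  change _ = κ * κ'⁻¹ * σ q *
    (f (T q.1, q.2 + ρ q.1) * (f' (fiberShift Y u (T q.1, q.2 + ρ q.1)))⁻¹)
  have h3 := congrArg (· * σ (fiberShift Y u q)) h2
  have e3 (a b c d : Circle) : a * b * (a⁻¹ * c⁻¹) * d = d * (b * c⁻¹) := by
    rw [mul_comm a b, mul_assoc b, mul_inv_cancel_left]; ac_rfl
  have e4 (a b c d e g : Circle) :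
      a * b * c * (d⁻¹ * e⁻¹ * g⁻¹) * e = a * d⁻¹ * b * (c * g⁻¹) := by
    calc _ = a * d⁻¹ * b * (c * g⁻¹) * (e * e⁻¹) := by ac_rfl
      _ = _ := by rw [mul_inv_cancel, mul_one]
  rwa [e3, e4] at h3

end SkewProduct

section Approximation

open Set

/-- If the `σ`-algebra is generated by the sets which are invariant under one of a decreasing
family of sets of measure preserving maps, then every integrable function is almost invariant in
mean under the maps far in the family. -/
lemma exists_forall_integral_comp_sub_le {Ω I : Type*} [Preorder I] [IsDirectedOrder I]
    [Nonempty I] [mΩ : MeasurableSpace Ω] {P : Measure Ω} [IsFiniteMeasure P]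
    {𝒲 : I → Set (Ω → Ω)} (hanti : Antitone 𝒲) (hW : ∀ i, ∀ W ∈ 𝒲 i, MeasurePreserving W P P)
    (hgen : mΩ =
      MeasurableSpace.generateFrom {A | MeasurableSet A ∧ ∃ i, ∀ W ∈ 𝒲 i, W ⁻¹' A = A})
    {Φ : Ω → ℂ} (hΦ : Integrable Φ P) {ε : ℝ} (hε : 0 < ε) :
    ∃ i, ∀ W ∈ 𝒲 i, ∫ ω, ‖Φ (W ω) - Φ ω‖ ∂P ≤ ε := by
  set 𝒜 := {A : Set Ω | MeasurableSet A ∧ ∃ i, ∀ W ∈ 𝒲 i, W ⁻¹' A = A}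
  have halg : IsSetAlgebra 𝒜 := by
    refine ⟨⟨.empty, Classical.arbitrary I, fun _ _ => rfl⟩, ?_, ?_⟩
    · rintro A ⟨hA, i, hi⟩
      exact ⟨hA.compl, i, fun W hWi => by rw [preimage_compl, hi W hWi]⟩
    · rintro A B ⟨hA, i, hi⟩ ⟨hB, j, hj⟩
      obtain ⟨k, hik, hjk⟩ := exists_ge_ge i j
      exact ⟨hA.union hB, k, fun W hWk => by
        rw [preimage_union, hi W (hanti hik hWk), hj W (hanti hjk hWk)]⟩
  have hdense := Measure.MeasureDense.of_generateFrom_isSetAlgebra_finite (μ := P) halg hgen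
  obtain ⟨g, hg, hgint, i, hi⟩ := (memLp_one_iff_integrable.2 hΦ).induction_dense ENNReal.one_ne_top
    (fun g => Integrable g P ∧ ∃ i, ∀ W ∈ 𝒲 i, ∀ ω, g (W ω) = g ω)
    (by
      intro c s hs hsP δ hδ
      obtain ⟨η, hη, hη'⟩ := exists_eLpNorm_indicator_le (μ := P) ENNReal.one_ne_top c hδ
      obtain ⟨t, ⟨ht, i, hi⟩, hst⟩ := hdense.approx s hs hsP.ne η hη
      refine ⟨t.indicator fun _ => c, ?_, (integrable_const c).indicator ht, i, fun W hWi ω => ?_⟩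
      · refine le_trans (le_of_eq ?_) (hη' (symmDiff s t) (hst.le.trans (by simp)))
        rw [eLpNorm_indicator_sub_indicator, symmDiff_comm]
      · have := Set.ext_iff.1 (hi W hWi) ω
        simp only [mem_preimage] at this
        by_cases h : ω ∈ t
        · rw [indicator_of_mem h, indicator_of_mem (this.2 h)]
        · rw [indicator_of_notMem h, indicator_of_notMem (mt this.1 h)])
    (by
      rintro f g ⟨hf, i, hi⟩ ⟨hg, j, hj⟩
      obtain ⟨k, hik, hjk⟩ := exists_ge_ge i j
      exact ⟨hf.add hg, k, fun W hWk ω => by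
        rw [Pi.add_apply, Pi.add_apply, hi W (hanti hik hWk), hj W (hanti hjk hWk)]⟩)
    (fun f hf => hf.1.aestronglyMeasurable) (ε := ENNReal.ofReal (ε / 2)) (by simpa using hε)
  have hle : ∫ ω, ‖(Φ - g) ω‖ ∂P ≤ ε / 2 := by
    rw [integral_norm_eq_lintegral_enorm (hΦ.sub hgint).aestronglyMeasurable,
      ← eLpNorm_one_eq_lintegral_enorm]
    exact ENNReal.toReal_le_of_le_ofReal (by linarith) hg
  refine ⟨i, fun W hWi => ?_⟩
  have hWP := hW i W hWi
  have hint : Integrable (fun ω => ‖(Φ - g) ω‖) P := (hΦ.sub hgint).norm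
  have hcomp : ∫ ω, ‖(Φ - g) (W ω)‖ ∂P = ∫ ω, ‖(Φ - g) ω‖ ∂P := by
    conv_rhs => rw [← hWP.map_eq]
    rw [integral_map hWP.measurable.aemeasurable]
    rw [hWP.map_eq]; exact hint.aestronglyMeasurable
  calc ∫ ω, ‖Φ (W ω) - Φ ω‖ ∂P ≤ ∫ ω, (‖(Φ - g) (W ω)‖ + ‖(Φ - g) ω‖) ∂P := by
        refine integral_mono ((hWP.integrable_comp_of_integrable hΦ).sub hΦ).norm
          ((hWP.integrable_comp_of_integrable hint).add hint) fun ω => ?_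
        simp only [Pi.sub_apply, hi W hWi]
        rw [norm_sub_rev (Φ ω)]
        refine le_trans (le_of_eq ?_) (norm_add_le _ _)
        congr 1; ring
    _ = ∫ ω, ‖(Φ - g) (W ω)‖ ∂P + ∫ ω, ‖(Φ - g) ω‖ ∂P :=
        integral_add (hWP.integrable_comp_of_integrable hint) hint
    _ ≤ ε := by rw [hcomp]; linarith

/-- The `σ`-algebra generated by an invariant measurable function is generated by invariant
measurable sets. -/
lemma comap_le_generateFrom_invariant {Ω I Z : Type*} [MeasurableSpace Ω] [MeasurableSpace Z]
    {𝒲 : I → Set (Ω → Ω)} {c : Ω → Z} (hc : Measurable c) {i : I}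
    (h : ∀ W ∈ 𝒲 i, ∀ ω, c (W ω) = c ω) :
    MeasurableSpace.comap c inferInstance ≤
      MeasurableSpace.generateFrom {A | MeasurableSet A ∧ ∃ i, ∀ W ∈ 𝒲 i, W ⁻¹' A = A} := by
  rintro _ ⟨B, hB, rfl⟩
  exact MeasurableSpace.measurableSet_generateFrom ⟨hc hB, i, fun W hW => by
    ext ω; simp only [Set.mem_preimage, h W hW]⟩

end Approximation

section FiberShift

open Circle

variable {Y ι G : Type*} [MeasurableSpace Y] {μ : Measure Y} [IsProbabilityMeasure μ]
  [AddCommGroup G] [MeasurableSpace G] [MeasurableAdd₂ G] {ν : Measure (ι → G)}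
  [IsProbabilityMeasure ν] [ν.IsAddLeftInvariant]

/-- The antidiagonal translations of `(ι → G) × (Y × (ι → G))` by vectors vanishing on `S`. -/
def antidiagonalShifts (Y G : Type*) {ι : Type*} [AddCommGroup G] (S : Finset ι) :
    Set ((ι → G) × (Y × (ι → G)) → (ι → G) × (Y × (ι → G))) :=
  {W | ∃ u : ι → G, (∀ i ∈ S, u i = 0) ∧ W = fun ω => (ω.1 + u, fiberShift Y (-u) ω.2)}

omit [MeasurableSpace Y] [MeasurableSpace G] [MeasurableAdd₂ G] in
lemma antitone_antidiagonalShifts :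
    Antitone (antidiagonalShifts Y G (ι := ι)) := by
  rintro S S' hS W ⟨u, hu, rfl⟩
  exact ⟨u, fun i hi => hu i (hS hi), rfl⟩

omit [MeasurableAdd₂ G] in
lemma generateFrom_invariant_antidiagonalShifts :
    (inferInstance : MeasurableSpace ((ι → G) × (Y × (ι → G)))) =
      MeasurableSpace.generateFrom
        {A | MeasurableSet A ∧ ∃ S, ∀ W ∈ antidiagonalShifts Y G S, W ⁻¹' A = A} := by
  refine le_antisymm ?_ (MeasurableSpace.generateFrom_le fun A hA => hA.1)
  refine sup_le ?_ ?_
  · conv_lhs => rw [MeasurableSpace.pi, MeasurableSpace.comap_iSup]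
    refine iSup_le fun i => ?_
    rw [MeasurableSpace.comap_comp]
    refine comap_le_generateFrom_invariant (i := {i}) (by fun_prop) ?_
    rintro _ ⟨u, hu, rfl⟩ ω
    simp [hu i]
  · conv_lhs => rw [Prod.instMeasurableSpace, MeasurableSpace.prod, MeasurableSpace.comap_sup]
    refine sup_le ?_ ?_
    · rw [MeasurableSpace.comap_comp]
      refine comap_le_generateFrom_invariant (i := ∅) (by fun_prop) ?_
      rintro _ ⟨u, hu, rfl⟩ ω
      rfl
    · conv_lhs => rw [MeasurableSpace.pi, MeasurableSpace.comap_iSup, MeasurableSpace.comap_iSup]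
      refine iSup_le fun i => ?_
      rw [MeasurableSpace.comap_comp, MeasurableSpace.comap_comp]
      refine comap_le_generateFrom_invariant (i := {i}) (by fun_prop) ?_
      rintro _ ⟨u, hu, rfl⟩ ω
      simp [fiberShift, hu i]

/-- Shifts by vectors which vanish on a large finite set of coordinates move a measurable family
of functions only slightly in mean. -/
lemma exists_finset_forall_integral_meanDev_le {f : (ι → G) → Y × (ι → G) → Circle}
    (hf : Measurable (Function.uncurry f)) {ε : ℝ} (hε : 0 < ε) :
    ∃ S : Finset ι, ∀ u : ι → G, (∀ i ∈ S, u i = 0) →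
      ∫ v, meanDev (μ.prod ν) (fun q => f (v + u) q * (f v (fiberShift Y u q))⁻¹) ∂ν ≤ ε := by
  have hint : Integrable (fun ω : (ι → G) × (Y × (ι → G)) => (f ω.1 ω.2 : ℂ))
      (ν.prod (μ.prod ν)) :=
    Integrable.of_bound (measurable_coe_comp hf).aestronglyMeasurable 1
      (.of_forall fun ω => (norm_coe _).le)
  have hpres : ∀ S, ∀ W ∈ antidiagonalShifts Y G (ι := ι) S,
      MeasurePreserving W (ν.prod (μ.prod ν)) (ν.prod (μ.prod ν)) := by
    rintro S _ ⟨u, -, rfl⟩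
    exact (measurePreserving_add_right ν u).prod (measurePreserving_fiberShift (-u))
  obtain ⟨S, hS⟩ := exists_forall_integral_comp_sub_le antitone_antidiagonalShifts hpres
    generateFrom_invariant_antidiagonalShifts hint hε
  refine ⟨S, fun u hu => le_trans (le_of_eq ?_) (hS _ ⟨u, hu, rfl⟩)⟩
  have hW := hpres S _ ⟨u, hu, rfl⟩
  refine Eq.trans ?_ (integral_prod _ ((hW.integrable_comp_of_integrable hint).sub hint).norm).symm
  refine integral_congr_ae (.of_forall fun v => ?_)
  have hφ : Measurable fun q => f (v + u) q * (f v (fiberShift Y u q))⁻¹ :=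
    hf.of_uncurry_left.mul (hf.of_uncurry_left.comp (measurePreserving_fiberShift
      (μ := μ) (ν := ν) u).measurable).inv
  have := meanDev_comp hφ (measurePreserving_fiberShift (μ := μ) (ν := ν) (-u))
  dsimp only
  rw [← this]
  refine integral_congr_ae (.of_forall fun q => ?_)
  simp only [dev_mul_inv, fiberShift, neg_add_cancel_right]
  rfl

end FiberShift

section ZeroOn

variable {ι G : Type*} [AddCommGroup G]

open Classical in
/-- The endomorphism of `ι → G` replacing the coordinates in `S` by zero. -/
noncomputable def zeroOn (G : Type*) {ι : Type*} [AddCommGroup G] (S : Finset ι) :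
    (ι → G) →+ (ι → G) where
  toFun h i := if i ∈ S then 0 else h i
  map_zero' := by ext; simp
  map_add' a b := by ext i; by_cases hi : i ∈ S <;> simp [hi]

lemma zeroOn_of_mem {S : Finset ι} {i : ι} (hi : i ∈ S) (h : ι → G) : zeroOn G S h i = 0 :=
  if_pos hi

lemma zeroOn_of_notMem {S : Finset ι} {i : ι} (hi : i ∉ S) (h : ι → G) :
    zeroOn G S h i = h i :=
  if_neg hi

lemma zeroOn_zeroOn (S : Finset ι) (h : ι → G) : zeroOn G S (zeroOn G S h) = zeroOn G S h := by
  ext i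
  by_cases hi : i ∈ S
  · rw [zeroOn_of_mem hi, zeroOn_of_mem hi]
  · rw [zeroOn_of_notMem hi]

/-- The subgroup of vectors vanishing on `S`. -/
def vanishingSubgroup (G : Type*) {ι : Type*} [AddCommGroup G] (S : Finset ι) :
    AddSubgroup (ι → G) :=
  (AddMonoidHom.pi fun i : S => Pi.evalAddMonoidHom (fun _ : ι => G) (i : ι)).ker

lemma mem_vanishingSubgroup {S : Finset ι} {h : ι → G} :
    h ∈ vanishingSubgroup G S ↔ ∀ i ∈ S, h i = 0 := by
  simp [vanishingSubgroup, AddMonoidHom.mem_ker, funext_iff]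

/-- Keeping only the coordinates in `S`, as a map on the quotient. -/
noncomputable def quotientLift (G : Type*) {ι : Type*} [AddCommGroup G] (S : Finset ι) :
    ((ι → G) ⧸ vanishingSubgroup G S) →+ (ι → G) :=
  QuotientAddGroup.lift _ (AddMonoidHom.id _ - zeroOn G S) fun h hh => by
    ext i
    by_cases hi : i ∈ S
    · simp [zeroOn_of_mem hi, mem_vanishingSubgroup.1 hh i hi]
    · simp [zeroOn_of_notMem hi]

lemma quotientLift_mk (S : Finset ι) (h : ι → G) :
    quotientLift G S (QuotientAddGroup.mk h) = h - zeroOn G S h :=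
  rfl

end ZeroOn

section Descent

open Circle

variable {Y ι G : Type*} [MeasurableSpace Y] {μ : Measure Y} [IsProbabilityMeasure μ]
  [AddCommGroup G] [MeasurableSpace G] [MeasurableAdd₂ G] [MeasurableNeg G] {ν : Measure (ι → G)}
  [IsProbabilityMeasure ν] [ν.IsAddLeftInvariant] {T : Y → Y} {ρ : Y → (ι → G)}

omit [MeasurableAdd₂ G] [MeasurableNeg G] in
lemma measurable_zeroOn (S : Finset ι) : Measurable (zeroOn G S) := by
  refine measurable_pi_lambda _ fun i => ?_
  by_cases hi : i ∈ S
  · simp only [zeroOn_of_mem hi, measurable_const]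
  · simp only [zeroOn_of_notMem hi]; fun_prop

lemma measurable_quotientLift (S : Finset ι) : Measurable (quotientLift G S) :=
  measurable_from_quotient.2 (measurable_id.sub (measurable_zeroOn S))

/-- If all the functions `σ ∘ fiberShift u / σ` are coboundaries up to constants, measurably in
`u`, then `σ` is cohomologous to a function which depends on finitely many fibre coordinates. -/
lemma exists_finset_cohomologous {σ : Y × (ι → G) → Circle}
    (hX : Ergodic (fun q : Y × (ι → G) => (T q.1, q.2 + ρ q.1)) (μ.prod ν)) (hσ : Measurable σ)
    {f : (ι → G) → Y × (ι → G) → Circle} (hf : Measurable (Function.uncurry f))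
    (hfσ : ∀ u, IsQuasiTransfer (μ.prod ν) (fun q : Y × (ι → G) => (T q.1, q.2 + ρ q.1)) σ
      (fiberShift Y u) (f u)) :
    ∃ (S : Finset ι) (w : ι → G) (s F : Y × (ι → G) → Circle), Measurable s ∧ Measurable F ∧
      ∀ᵐ q ∂μ.prod ν, σ q = s (q.1, q.2 + zeroOn G S (w - q.2)) *
        (F (T q.1, q.2 + ρ q.1) * (F q)⁻¹) := by
  classical
  obtain ⟨S₁, hS₁⟩ := exists_finset_forall_integral_meanDev_le (μ := μ) (ν := ν) hf
    (by norm_num : (0 : ℝ) < 1 / 800)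
  obtain ⟨S₂, hS₂⟩ := exists_finset_forall_integral_meanDev_le (μ := μ) (ν := ν)
    (f := fun _ => σ) (hσ.comp measurable_snd) (by norm_num : (0 : ℝ) < 1 / 4)
  set p := zeroOn G (S₁ ∪ S₂)
  have hpm : Measurable p := measurable_zeroOn _
  have hp (u : ι → G) {i : ι} (hi : i ∈ S₁ ∪ S₂) : p u i = 0 := zeroOn_of_mem hi u
  have hVm : Measurable fun z : (ι → G) × (Y × (ι → G)) => fiberShift Y (p z.1) z.2 :=
    Measurable.prodMk (by fun_prop) (by fun_prop)
  obtain ⟨g, hgm, hg, hgσ⟩ := exists_cocycle_of_quasiTransfer (ν := ν) hX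
    (V := fun u => fiberShift Y (p u)) hVm (fun u => measurePreserving_fiberShift (p u))
    (fun u v q => by simp only [fiberShift, map_add, add_assoc])
    (fun u q => by simp only [fiberShift, add_right_comm]) hσ
    (φ := fun u v q => f (v + p u) q * (f v (fiberShift Y (p u) q))⁻¹)
    ((hf.comp (f := fun z : (ι → G) × ((ι → G) × (Y × (ι → G))) => (z.2.1 + p z.1, z.2.2))
        (by fun_prop)).mul
      (hf.comp (f := fun z : (ι → G) × ((ι → G) × (Y × (ι → G))) =>
        (z.2.1, fiberShift Y (p z.1) z.2.2)) (Measurable.prodMk (by fun_prop)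
          (hVm.comp (f := fun z : (ι → G) × ((ι → G) × (Y × (ι → G))) => (z.1, z.2.2))
            (by fun_prop)))).inv)
    (fun u v => (hfσ (v + p u)).div_fiberShift (hfσ v))
    (fun u => (hS₁ (p u) fun i hi => hp u (Finset.mem_union_left _ hi)).trans_lt (by norm_num))
    (fun u => by
      have := hS₂ (p u) fun i hi => hp u (Finset.mem_union_right _ hi)
      rw [integral_const, probReal_univ, one_smul, ← meanDev_inv] at this
      simpa only [mul_inv_rev, inv_inv] using this)
  obtain ⟨w, s, F, hs, hF, h⟩ := exists_cohomologous_of_cocycle hX.toMeasurePreserving hσ hpm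
    (zeroOn_zeroOn _) hgm hg hgσ
  exact ⟨_, w, s, F, hs, hF, h⟩

end Descent

section Topology

variable {ι G : Type*} [AddCommGroup G] [TopologicalSpace G] [T2Space G]

lemma isClosed_vanishingSubgroup (S : Finset ι) :
    IsClosed (vanishingSubgroup G S : Set (ι → G)) := by
  have : (vanishingSubgroup G S : Set (ι → G)) = ⋂ i ∈ S, {h | h i = 0} := by
    ext; simp [mem_vanishingSubgroup]
  rw [this]
  exact isClosed_biInter fun i _ => isClosed_eq (by fun_prop) continuous_const

/-- The quotient of a power of a compact group by the vectors vanishing on a finite set of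
coordinates is a finite power of the group. -/
lemma exists_homeomorph_quotient_vanishingSubgroup [IsTopologicalAddGroup G]
    [CompactSpace G] (S : Finset ι) :
    ∃ (n : ℕ) (e : ((ι → G) ⧸ vanishingSubgroup G S) ≃ₜ (Fin n → G)),
      ∀ a b, e (a + b) = e a + e b := by
  classical
  set E : (ι → G) →+ (S → G) :=
    AddMonoidHom.pi fun i : S => Pi.evalAddMonoidHom (fun _ : ι => G) (i : ι)
  have hE : Function.Surjective E := fun k =>
    ⟨fun i => if hi : i ∈ S then k ⟨i, hi⟩ else 0, by ext i; simp [E]⟩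
  set e₀ : ((ι → G) ⧸ vanishingSubgroup G S) ≃+ (S → G) :=
    QuotientAddGroup.quotientKerEquivOfSurjective E hE
  have he₀ : Continuous e₀ := by
    refine continuous_quot_lift _ ?_
    exact continuous_pi fun i => continuous_apply (i : ι)
  refine ⟨S.card, (he₀.homeoOfEquivCompactToT2 (f := e₀.toEquiv)).trans
    (Homeomorph.piCongrLeft (Y := fun _ => G) S.equivFin), fun a b => ?_⟩
  ext k
  obtain ⟨i, rfl⟩ := S.equivFin.surjective k
  have key (c : S → G) : Homeomorph.piCongrLeft (Y := fun _ => G) S.equivFin c (S.equivFin i) =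
      c i := Equiv.piCongrLeft_apply_apply (fun _ => G) S.equivFin c i
  change Homeomorph.piCongrLeft (Y := fun _ => G) S.equivFin (e₀ (a + b)) (S.equivFin i) =
    Homeomorph.piCongrLeft (Y := fun _ => G) S.equivFin (e₀ a) (S.equivFin i) +
      Homeomorph.piCongrLeft (Y := fun _ => G) S.equivFin (e₀ b) (S.equivFin i)
  rw [key, key, key, map_add, Pi.add_apply]

end Topology

/-- Let `H = (ℝ/ℤ)^ι` be a (possibly infinite-dimensional) torus and `X = Y ×_ρ H` an ergodic
abelian extension of an ergodic system `Y`. If `σ(y,h+u)/σ(y,h) = λ_u · f_u∘T_X / f_u` a.e.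
for a measurable family `(f_u, λ_u)`, then `σ` is cohomologous to a cocycle lifted from
`Y × (H/J)` for some closed subgroup `J ≤ H` with `H/J` a finite-dimensional torus. -/
theorem cocycle_descends_to_finite_dimensional_torus
    {Y ι : Type*} [MeasurableSpace Y] [Countable ι]
    (μ : Measure Y) [IsProbabilityMeasure μ]
    (ν : Measure (ι → AddCircle (1 : ℝ))) [IsProbabilityMeasure ν] [ν.IsAddHaarMeasure]
    (T : Y → Y) (hT : Ergodic T μ)
    (ρ : Y → (ι → AddCircle (1 : ℝ))) (hρ : Measurable ρ)
    (hX : Ergodic (fun p : Y × (ι → AddCircle (1 : ℝ)) => (T p.1, p.2 + ρ p.1)) (μ.prod ν))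
    (σ : Y × (ι → AddCircle (1 : ℝ)) → ℂ) (hσmeas : Measurable σ) (hσ1 : ∀ p, ‖σ p‖ = 1)
    (f : (ι → AddCircle (1 : ℝ)) → Y × (ι → AddCircle (1 : ℝ)) → ℂ)
    (lam : (ι → AddCircle (1 : ℝ)) → ℂ)
    (hfmeas : Measurable (Function.uncurry f)) (hf1 : ∀ u p, ‖f u p‖ = 1)
    (hlammeas : Measurable lam) (hlam1 : ∀ u, ‖lam u‖ = 1)
    (heq : ∀ u : ι → AddCircle (1 : ℝ), ∀ᵐ p ∂(μ.prod ν),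
      σ (p.1, p.2 + u) / σ p = lam u * (f u (T p.1, p.2 + ρ p.1) / f u p)) :
    ∃ J : AddSubgroup (ι → AddCircle (1 : ℝ)), IsClosed (J : Set (ι → AddCircle (1 : ℝ))) ∧
      (∃ (n : ℕ) (e : ((ι → AddCircle (1 : ℝ)) ⧸ J) ≃ₜ (Fin n → AddCircle (1 : ℝ))),
        ∀ a b : (ι → AddCircle (1 : ℝ)) ⧸ J, e (a + b) = e a + e b) ∧
      ∃ (σ' : Y × ((ι → AddCircle (1 : ℝ)) ⧸ J) → ℂ)
        (F : Y × (ι → AddCircle (1 : ℝ)) → ℂ),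
        Measurable σ' ∧ (∀ q, ‖σ' q‖ = 1) ∧ Measurable F ∧ (∀ p, ‖F p‖ = 1) ∧
        ∀ᵐ p ∂(μ.prod ν),
          σ p = σ' (p.1, QuotientAddGroup.mk p.2) * (F (T p.1, p.2 + ρ p.1) / F p) := by
  have hσ0 (q : Y × (ι → AddCircle (1 : ℝ))) : σ q ≠ 0 :=
    norm_ne_zero_iff.1 (by rw [hσ1]; exact one_ne_zero)
  have hf0 (u : ι → AddCircle (1 : ℝ)) (q : Y × (ι → AddCircle (1 : ℝ))) : f u q ≠ 0 :=
    norm_ne_zero_iff.1 (by rw [hf1]; exact one_ne_zero)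
  have hcoe {z : ℂ} (hz : ‖z‖ = 1) : (Circle.ofComplex z : ℂ) = z := by
    rw [Circle.coe_ofComplex (norm_ne_zero_iff.1 (by rw [hz]; exact one_ne_zero)), hz]
    simp
  obtain ⟨S, w, s, F, hs, hF, h⟩ := exists_finset_cohomologous (μ := μ) (ν := ν)
    (G := AddCircle (1 : ℝ)) (σ := fun q => Circle.ofComplex (σ q)) hX
    (Circle.measurable_ofComplex.comp hσmeas)
    (f := fun u q => Circle.ofComplex (f u q)) (Circle.measurable_ofComplex.comp hfmeas)
    (fun u => ⟨Circle.ofComplex (lam u), (heq u).mono fun q hq => by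
      rw [← mul_div_assoc, div_eq_div_iff (hσ0 _) (hf0 _ _)] at hq
      apply Circle.ext
      simp only [Circle.coe_mul, hcoe, hσ1, hf1, hlam1, fiberShift]
      rw [hq]; ring⟩)
  refine ⟨vanishingSubgroup _ S, isClosed_vanishingSubgroup S,
    exists_homeomorph_quotient_vanishingSubgroup S,
    fun z => s (z.1, quotientLift _ S z.2 + zeroOn _ S w), fun q => F q,
    Circle.measurable_coe_comp (hs.comp (measurable_fst.prodMk
      (((measurable_quotientLift S).comp measurable_snd).add_const _))),
    fun _ => Circle.norm_coe _, Circle.measurable_coe_comp hF, fun _ => Circle.norm_coe _,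
    h.mono fun q hq => ?_⟩
  have e : q.2 + zeroOn _ S (w - q.2) =
      quotientLift _ S (QuotientAddGroup.mk q.2) + zeroOn _ S w := by
    rw [quotientLift_mk, map_sub]; abel
  rw [e] at hq
  rw [← hcoe (hσ1 q), hq]
  simp [div_eq_mul_inv]
end
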